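/- Let G be an SSG possessing an optimal MAX strategy, and let x ∈ V_MAX have exactly d out-neighbours. Then any family of MAX strategies whose switch sets all equal the singleton {x} and whose value vectors v_σ are pairwise distinct has cardinality at most d − 1. -/

import Mathlib

open scoped BigOperators

instance : Fact ((0:ℝ) ≤ 1) := ⟨zero_le_one⟩

/-- A simple stochastic game on a finite vertex set `V`. -/
structure SSG (V : Type*) [Fintype V] [DecidableEq V] where
  /-- MAX vertices -/
  VMax : Finset V
  /-- MIN vertices -/
  VMin : Finset V
  /-- random vertices -/
  VR : Finset V
  /-- sink vertices -/
  VS : Finset V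
  cover : ∀ x : V, x ∈ VMax ∨ x ∈ VMin ∨ x ∈ VR ∨ x ∈ VS
  disjMaxMin : Disjoint VMax VMin
  disjMaxR : Disjoint VMax VR
  disjMaxS : Disjoint VMax VS
  disjMinR : Disjoint VMin VR
  disjMinS : Disjoint VMin VS
  disjRS : Disjoint VR VS
  /-- out-neighbourhood: `y ∈ succ x` iff `(x,y)` is an edge -/
  succ : V → Finset V
  outMax : ∀ x ∈ VMax, 2 ≤ (succ x).card
  outMin : ∀ x ∈ VMin, 2 ≤ (succ x).card
  outR : ∀ x ∈ VR, 1 ≤ (succ x).card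
  /-- transition probabilities at random vertices -/
  prob : V → V → ℝ
  prob_nonneg : ∀ x y, 0 ≤ prob x y
  prob_support : ∀ x ∈ VR, ∀ y, y ∉ succ x → prob x y = 0
  prob_sum : ∀ x ∈ VR, (∑ y, prob x y) = 1
  /-- values of the sinks -/
  val : V → ℝ
  val_mem : ∀ x ∈ VS, val x ∈ Set.Icc (0:ℝ) 1

namespace SSG

variable {V : Type*} [Fintype V] [DecidableEq V]

/-- A positional MAX strategy: a choice of an out-neighbour at every MAX vertex
(normalised to the identity away from `VMax`). -/
structure MaxStrategy (G : SSG V) where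
  toFun : V → V
  mem_succ : ∀ x ∈ G.VMax, toFun x ∈ G.succ x
  eq_id : ∀ x ∉ G.VMax, toFun x = x

/-- A positional MIN strategy. -/
structure MinStrategy (G : SSG V) where
  toFun : V → V
  mem_succ : ∀ x ∈ G.VMin, toFun x ∈ G.succ x
  eq_id : ∀ x ∉ G.VMin, toFun x = x

/-- The one-step (monotone) operator on value vectors associated with `(σ,τ)`. -/
noncomputable def F (G : SSG V) (σ : G.MaxStrategy) (τ : G.MinStrategy)
    (w : V → unitInterval) (x : V) : unitInterval :=
  if _hM : x ∈ G.VMax then w (σ.toFun x)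
  else if _hN : x ∈ G.VMin then w (τ.toFun x)
  else if hR : x ∈ G.VR then
    ⟨∑ y, G.prob x y * (w y : ℝ), by
      constructor
      · exact Finset.sum_nonneg fun y _ =>
          mul_nonneg (G.prob_nonneg x y) (w y).2.1
      · calc (∑ y, G.prob x y * (w y : ℝ)) ≤ ∑ y, G.prob x y :=
              Finset.sum_le_sum fun y _ =>
                mul_le_of_le_one_right (G.prob_nonneg x y) (w y).2.2
          _ = 1 := G.prob_sum x hR⟩
  else ⟨G.val x, G.val_mem x (by
    rcases G.cover x with h | h | h | h
    · exact absurd h _hM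
    · exact absurd h _hN
    · exact absurd h hR
    · exact h)⟩

/-- The value vector `v_{σ,τ}`: the least fixed point (à la Knaster–Tarski) of `F`. -/
noncomputable def value (G : SSG V) (σ : G.MaxStrategy) (τ : G.MinStrategy) :
    V → unitInterval :=
  sInf {w : V → unitInterval | G.F σ τ w ≤ w}

/-- `τ` is a best response to `σ`. -/
def IsBestResponse (G : SSG V) (σ : G.MaxStrategy) (τ : G.MinStrategy) : Prop :=
  ∀ τ' : G.MinStrategy, G.value σ τ ≤ G.value σ τ'

/-- `σ` is an optimal MAX strategy: `v_σ ≥ v_{σ'}` for every MAX strategy `σ'`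
(values being computed against best responses). -/
def IsOptimal (G : SSG V) (σ : G.MaxStrategy) : Prop :=
  ∀ τ : G.MinStrategy, G.IsBestResponse σ τ →
    ∀ σ' : G.MaxStrategy, ∀ τ' : G.MinStrategy, G.IsBestResponse σ' τ' →
      G.value σ' τ' ≤ G.value σ τ

/-- The switch set `S_σ` of `σ`, computed with a best response `τ` to `σ`. -/
def switchSet (G : SSG V) (σ : G.MaxStrategy) (τ : G.MinStrategy) : Set V :=
  {x | x ∈ G.VMax ∧ ∃ y ∈ G.succ x, G.value σ τ x < G.value σ τ y}

/-- `σ'` is a `σ`-switch (w.r.t. a best response `τ` to `σ`). -/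
def IsSwitch (G : SSG V) (σ : G.MaxStrategy) (τ : G.MinStrategy)
    (σ' : G.MaxStrategy) : Prop :=
  σ' ≠ σ ∧
  (∀ x ∈ G.VMax, x ∉ G.switchSet σ τ → σ'.toFun x = σ.toFun x) ∧
  (∀ x ∈ G.switchSet σ τ, σ'.toFun x ≠ σ.toFun x →
    G.value σ τ x < G.value σ τ (σ'.toFun x))

/-- `σ` agrees with `σ₀` on `T`. -/
def AgreesOn (G : SSG V) (T : Set V) (σ₀ σ : G.MaxStrategy) : Prop :=
  ∀ x ∈ T, σ.toFun x = σ₀.toFun x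

/-- `σ` is an optimal MAX strategy of the subgame `G_{|T[σ₀]}`: it agrees with `σ₀` on `T`
and its value vector dominates that of every MAX strategy of `G` agreeing with `σ₀` on `T`. -/
def IsOptimalOn (G : SSG V) (T : Set V) (σ₀ σ : G.MaxStrategy) : Prop :=
  G.AgreesOn T σ₀ σ ∧
  ∀ σ' : G.MaxStrategy, G.AgreesOn T σ₀ σ' →
    ∀ τ τ' : G.MinStrategy, G.IsBestResponse σ τ → G.IsBestResponse σ' τ' →
      G.value σ' τ' ≤ G.value σ τ

/-- `σ'` is a `(σ,T)`-super-switch (w.r.t. a best response `τ` to `σ`): it is obtained from an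
intermediate `σ`-switch `σ''` that only switches inside `T`, by taking an optimal strategy of
the subgame `G_{|T[σ'']}`. -/
def IsSuperSwitch (G : SSG V) (σ : G.MaxStrategy) (τ : G.MinStrategy)
    (T : Set V) (σ' : G.MaxStrategy) : Prop :=
  ∃ σ'' : G.MaxStrategy, G.IsSwitch σ τ σ'' ∧
    (∀ x ∈ G.VMax, x ∉ T → σ''.toFun x = σ.toFun x) ∧
    G.IsOptimalOn T σ'' σ'

/-- A binary SSG: every MAX vertex has outdegree exactly 2. -/
def Binary (G : SSG V) : Prop := ∀ x ∈ G.VMax, (G.succ x).card = 2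

/-- `σb` is the total switch `σ̄` of `σ` (in a binary SSG): it switches to the other
out-neighbour exactly on the switch set of `σ`. -/
def IsTotalSwitch (G : SSG V) (σ : G.MaxStrategy) (τ : G.MinStrategy)
    (σb : G.MaxStrategy) : Prop :=
  (∀ x ∈ G.switchSet σ τ, σb.toFun x ≠ σ.toFun x) ∧
  (∀ x ∈ G.VMax, x ∉ G.switchSet σ τ → σb.toFun x = σ.toFun x)

end SSG

namespace SSG

variable {V : Type*} [Fintype V] [DecidableEq V]

theorem F_max (G : SSG V) (σ : G.MaxStrategy) (τ : G.MinStrategy) (w : V → unitInterval)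
    {z : V} (h : z ∈ G.VMax) : G.F σ τ w z = w (σ.toFun z) := by
  simp [F, h]

theorem F_min (G : SSG V) (σ : G.MaxStrategy) (τ : G.MinStrategy) (w : V → unitInterval)
    {z : V} (h : z ∈ G.VMin) : G.F σ τ w z = w (τ.toFun z) := by
  have h1 : z ∉ G.VMax := fun h' => Finset.disjoint_left.1 G.disjMaxMin h' h
  simp [F, h, h1]

theorem F_rand (G : SSG V) (σ : G.MaxStrategy) (τ : G.MinStrategy) (w : V → unitInterval)
    {z : V} (h : z ∈ G.VR) : (G.F σ τ w z : ℝ) = ∑ y, G.prob z y * (w y : ℝ) := by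
  have h1 : z ∉ G.VMax := fun h' => Finset.disjoint_left.1 G.disjMaxR h' h
  have h2 : z ∉ G.VMin := fun h' => Finset.disjoint_left.1 G.disjMinR h' h
  simp [F, h, h1, h2]

theorem F_sink (G : SSG V) (σ : G.MaxStrategy) (τ : G.MinStrategy) (w : V → unitInterval)
    {z : V} (h : z ∈ G.VS) : (G.F σ τ w z : ℝ) = G.val z := by
  have h1 : z ∉ G.VMax := fun h' => Finset.disjoint_left.1 G.disjMaxS h' h
  have h2 : z ∉ G.VMin := fun h' => Finset.disjoint_left.1 G.disjMinS h' h
  have h3 : z ∉ G.VR := fun h' => Finset.disjoint_left.1 G.disjRS h' h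
  simp [F, h1, h2, h3]

theorem F_mono (G : SSG V) (σ : G.MaxStrategy) (τ : G.MinStrategy) :
    Monotone (G.F σ τ) := by
  intro w w' hw z
  rcases G.cover z with h | h | h | h
  · rw [F_max _ _ _ _ h, F_max _ _ _ _ h]; exact hw _
  · rw [F_min _ _ _ _ h, F_min _ _ _ _ h]; exact hw _
  · rw [← Subtype.coe_le_coe, F_rand _ _ _ _ h, F_rand _ _ _ _ h]
    exact Finset.sum_le_sum fun y _ => mul_le_mul_of_nonneg_left (hw y) (G.prob_nonneg z y)
  · rw [← Subtype.coe_le_coe, F_sink _ _ _ _ h, F_sink _ _ _ _ h]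

theorem value_le (G : SSG V) (σ : G.MaxStrategy) (τ : G.MinStrategy) {w : V → unitInterval}
    (h : G.F σ τ w ≤ w) : G.value σ τ ≤ w := sInf_le h

theorem F_value (G : SSG V) (σ : G.MaxStrategy) (τ : G.MinStrategy) :
    G.F σ τ (G.value σ τ) = G.value σ τ := by
  have h1 : G.F σ τ (G.value σ τ) ≤ G.value σ τ := by
    refine le_sInf fun w hw => ?_
    exact (G.F_mono σ τ (G.value_le σ τ hw)).trans hw
  exact le_antisymm h1 (G.value_le σ τ (G.F_mono σ τ h1))

theorem value_max (G : SSG V) (σ : G.MaxStrategy) (τ : G.MinStrategy)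
    {z : V} (h : z ∈ G.VMax) : G.value σ τ z = G.value σ τ (σ.toFun z) := by
  rw [← F_max G σ τ (G.value σ τ) h, F_value]

theorem value_min (G : SSG V) (σ : G.MaxStrategy) (τ : G.MinStrategy)
    {z : V} (h : z ∈ G.VMin) : G.value σ τ z = G.value σ τ (τ.toFun z) := by
  rw [← F_min G σ τ (G.value σ τ) h, F_value]

theorem value_rand (G : SSG V) (σ : G.MaxStrategy) (τ : G.MinStrategy)
    {z : V} (h : z ∈ G.VR) :
    (G.value σ τ z : ℝ) = ∑ y, G.prob z y * (G.value σ τ y : ℝ) := by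
  rw [← F_rand G σ τ _ h, F_value]

theorem value_sink (G : SSG V) (σ : G.MaxStrategy) (τ : G.MinStrategy)
    {z : V} (h : z ∈ G.VS) : (G.value σ τ z : ℝ) = G.val z := by
  rw [← F_sink G σ τ (G.value σ τ) h, F_value]

/-- A criterion for being a pre-fixed point that only looks at MAX and MIN vertices. -/
theorem value_le_value (G : SSG V) (σ σ' : G.MaxStrategy) (τ τ' : G.MinStrategy)
    (hM : ∀ z ∈ G.VMax, G.value σ τ (σ'.toFun z) ≤ G.value σ τ z)
    (hN : ∀ z ∈ G.VMin, G.value σ τ (τ'.toFun z) ≤ G.value σ τ z) :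
    G.value σ' τ' ≤ G.value σ τ := by
  refine G.value_le _ _ fun z => ?_
  rcases G.cover z with h | h | h | h
  · rw [F_max _ _ _ _ h]; exact hM z h
  · rw [F_min _ _ _ _ h]; exact hN z h
  · rw [← Subtype.coe_le_coe, F_rand _ _ _ _ h, value_rand _ _ _ h]
  · rw [← Subtype.coe_le_coe, F_sink _ _ _ _ h, value_sink _ _ _ h]

/-- Update of a MAX strategy at a vertex. -/
def updMax (G : SSG V) (σ : G.MaxStrategy) (x y : V) (hx : x ∈ G.VMax) (hy : y ∈ G.succ x) :
    G.MaxStrategy where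
  toFun := Function.update σ.toFun x y
  mem_succ z hz := by
    by_cases h : z = x
    · subst h; simpa using hy
    · simpa [h] using σ.mem_succ z hz
  eq_id z hz := by
    have h : z ≠ x := fun h => hz (h ▸ hx)
    simpa [h] using σ.eq_id z hz

/-- Update of a MIN strategy at a vertex. -/
def updMin (G : SSG V) (σ : G.MinStrategy) (x y : V) (hx : x ∈ G.VMin) (hy : y ∈ G.succ x) :
    G.MinStrategy where
  toFun := Function.update σ.toFun x y
  mem_succ z hz := by
    by_cases h : z = x
    · subst h; simpa using hy
    · simpa [h] using σ.mem_succ z hz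
  eq_id z hz := by
    have h : z ≠ x := fun h => hz (h ▸ hx)
    simpa [h] using σ.eq_id z hz

/-- A best response is locally optimal at MIN vertices. -/
theorem br_le (G : SSG V) (σ : G.MaxStrategy) (τ : G.MinStrategy) (hb : G.IsBestResponse σ τ)
    {m n : V} (hm : m ∈ G.VMin) (hn : n ∈ G.succ m) : G.value σ τ m ≤ G.value σ τ n := by
  by_contra! hlt
  have h1 : G.value σ (G.updMin τ m n hm hn) ≤ G.value σ τ := by
    apply value_le_value
    · intro z hz; exact (G.value_max σ τ hz).ge
    · intro z hz
      by_cases h : z = m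
      · subst h; simpa [updMin] using hlt.le
      · simpa [updMin, h] using (G.value_min σ τ hz).ge
  have h2 := hb (G.updMin τ m n hm hn) m
  rw [G.value_min σ (G.updMin τ m n hm hn) hm] at h2
  have h3 := h1 n
  simp only [updMin, Function.update_self] at h2 h3
  exact absurd (h2.trans h3) (not_le.2 hlt)

/-- Two MIN strategies have a common improvement. -/
theorem exists_common (G : SSG V) (σ : G.MaxStrategy) (τ τ' : G.MinStrategy) :
    ∃ τ'' : G.MinStrategy, G.value σ τ'' ≤ G.value σ τ ∧ G.value σ τ'' ≤ G.value σ τ' := by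
  classical
  let t : G.MinStrategy :=
    { toFun := fun z => if G.value σ τ z ≤ G.value σ τ' z then τ.toFun z else τ'.toFun z
      mem_succ := fun z hz => by
        split_ifs
        · exact τ.mem_succ z hz
        · exact τ'.mem_succ z hz
      eq_id := fun z hz => by
        split_ifs
        · exact τ.eq_id z hz
        · exact τ'.eq_id z hz }
  have key : G.value σ t ≤ G.value σ τ ⊓ G.value σ τ' := by
    refine G.value_le _ _ fun z => ?_
    rcases G.cover z with h | h | h | h
    · rw [F_max _ _ _ _ h, Pi.inf_apply, Pi.inf_apply, ← value_max _ _ _ h, ← value_max _ _ _ h]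
    · rw [F_min _ _ _ _ h]
      by_cases hc : G.value σ τ z ≤ G.value σ τ' z
      · have ht : t.toFun z = τ.toFun z := if_pos hc
        rw [ht, Pi.inf_apply, Pi.inf_apply, inf_eq_left.2 hc, G.value_min σ τ h]
        exact inf_le_left
      · have ht : t.toFun z = τ'.toFun z := if_neg hc
        rw [ht, Pi.inf_apply, Pi.inf_apply, inf_eq_right.2 (not_le.1 hc).le, G.value_min σ τ' h]
        exact inf_le_right
    · refine le_inf ?_ ?_
      · rw [← F_value G σ τ, ← Subtype.coe_le_coe, F_rand _ _ _ _ h, F_rand _ _ _ _ h]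
        refine Finset.sum_le_sum fun y _ => mul_le_mul_of_nonneg_left ?_ (G.prob_nonneg z y)
        rw [F_value]
        exact inf_le_left (a := G.value σ τ y) (b := G.value σ τ' y)
      · rw [← F_value G σ τ', ← Subtype.coe_le_coe, F_rand _ _ _ _ h, F_rand _ _ _ _ h]
        refine Finset.sum_le_sum fun y _ => mul_le_mul_of_nonneg_left ?_ (G.prob_nonneg z y)
        rw [F_value]
        exact inf_le_right (a := G.value σ τ y) (b := G.value σ τ' y)
    · refine le_inf ?_ ?_
      · rw [← Subtype.coe_le_coe, F_sink _ _ _ _ h, value_sink _ _ _ h]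
      · rw [← Subtype.coe_le_coe, F_sink _ _ _ _ h, value_sink _ _ _ h]
  exact ⟨t, key.trans inf_le_left, key.trans inf_le_right⟩

theorem exists_br (G : SSG V) (σ : G.MaxStrategy) : ∃ τ, G.IsBestResponse σ τ := by
  classical
  have hfin : Finite G.MinStrategy :=
    Finite.of_injective (fun t : G.MinStrategy => t.toFun) (by
      rintro ⟨a, _, _⟩ ⟨b, _, _⟩ h
      simpa using h)
  have hne : Nonempty G.MinStrategy := by
    have h : ∀ z, ∃ y, (z ∈ G.VMin → y ∈ G.succ z) ∧ (z ∉ G.VMin → y = z) := by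
      intro z
      by_cases hz : z ∈ G.VMin
      · have h2 := G.outMin z hz
        obtain ⟨y, hy⟩ := Finset.card_pos.1 (show 0 < (G.succ z).card by omega)
        exact ⟨y, fun _ => hy, fun h => absurd hz h⟩
      · exact ⟨z, fun h => absurd h hz, fun _ => rfl⟩
    choose f hf using h
    exact ⟨⟨f, fun z => (hf z).1, fun z => (hf z).2⟩⟩
  obtain ⟨τ, hτ⟩ := Finite.exists_min
    (fun τ : G.MinStrategy => ∑ z, (G.value σ τ z : ℝ))
  refine ⟨τ, fun τ' => ?_⟩
  obtain ⟨t, h1, h2⟩ := G.exists_common σ τ τ'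
  have heq : ∀ z ∈ Finset.univ, (G.value σ t z : ℝ) = G.value σ τ z := by
    refine (Finset.sum_eq_sum_iff_of_le (f := fun z => (G.value σ t z : ℝ))
      (g := fun z => (G.value σ τ z : ℝ)) fun z _ => h1 z).1 ?_
    exact le_antisymm (Finset.sum_le_sum fun z _ => h1 z) (hτ t)
  intro z
  have := heq z (Finset.mem_univ z)
  rw [← Subtype.ext this]
  exact h2 z

/-- Switching a single improving vertex improves the value vector. -/
theorem switch_improves (G : SSG V) (σ : G.MaxStrategy) (τ : G.MinStrategy)
    (hb : G.IsBestResponse σ τ) {x y : V} (hx : x ∈ G.VMax) (hy : y ∈ G.succ x)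
    (hlt : G.value σ τ x < G.value σ τ y) (τ' : G.MinStrategy) :
    G.value σ τ ≤ G.value (G.updMax σ x y hx hy) τ' := by
  set σ' := G.updMax σ x y hx hy with hσ'
  set v := G.value σ τ with hv
  set u := G.value σ' τ' with hu
  have hσx : σ'.toFun x = y := by simp [hσ', updMax]
  have hσz : ∀ z, z ≠ x → σ'.toFun z = σ.toFun z := fun z hz => by simp [hσ', updMax, hz]
  have : Nonempty V := ⟨x⟩
  obtain ⟨z₀, hz₀⟩ := Finite.exists_max (fun z => (v z : ℝ) - u z)
  set M := (v z₀ : ℝ) - u z₀ with hM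
  by_cases hpos : M ≤ 0
  · intro z
    have := hz₀ z
    rw [← Subtype.coe_le_coe]
    linarith
  exfalso
  push Not at hpos
  classical
  let w : V → unitInterval := fun z => if (v z : ℝ) - u z = M then 0 else 1
  have hw : G.value σ τ' ≤ w := by
    refine G.value_le _ _ fun z => ?_
    by_cases hD : (v z : ℝ) - u z = M
    swap
    · simp only [w, if_neg hD]; exact unitInterval.le_one'
    have hwD : ∀ a, (v a : ℝ) - u a = M → w a = 0 := fun a ha => if_pos ha
    rw [hwD z hD]
    rcases G.cover z with h | h | h | h
    · rw [F_max _ _ _ _ h]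
      have e : (u z : ℝ) = u (σ'.toFun z) := by rw [hu, ← value_max _ _ _ h]
      have hne : z ≠ x := by
        rintro rfl
        rw [hσx] at e
        have h1 := hz₀ y
        have h2 : (v z : ℝ) < v y := hlt
        linarith
      rw [hσz z hne] at e
      have e2 : (v z : ℝ) = v (σ.toFun z) := by rw [hv, ← value_max _ _ _ h]
      exact (hwD _ (by rw [← e, ← e2, hD])).le
    · rw [F_min _ _ _ _ h]
      have e : (u z : ℝ) = u (τ'.toFun z) := by rw [hu, ← value_min _ _ _ h]
      have e2 : (v z : ℝ) ≤ v (τ'.toFun z) := G.br_le σ τ hb h (τ'.mem_succ z h)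
      have h1 := hz₀ (τ'.toFun z)
      exact (hwD _ (by linarith)).le
    · rw [← Subtype.coe_le_coe, F_rand _ _ _ _ h]
      have e1 := G.value_rand σ τ h
      have e2 := G.value_rand σ' τ' h
      have e3 : ∑ a, G.prob z a * (M - ((v a : ℝ) - u a)) = 0 := by
        simp only [mul_sub, Finset.sum_sub_distrib, ← Finset.sum_mul, G.prob_sum z h]
        rw [← hv] at e1
        rw [← hu] at e2
        rw [← e1, ← e2]
        linarith
      rw [Finset.sum_eq_zero_iff_of_nonneg (fun a _ => mul_nonneg (G.prob_nonneg z a)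
        (sub_nonneg.2 (hz₀ a)))] at e3
      refine (Finset.sum_eq_zero fun a ha => ?_).le
      rcases mul_eq_zero.1 (e3 a ha) with h0 | h0
      · rw [h0, zero_mul]
      · rw [hwD a (by linarith)]; simp
    · exfalso
      have e1 := G.value_sink σ τ h
      have e2 := G.value_sink σ' τ' h
      rw [← hv] at e1
      rw [← hu] at e2
      linarith
  have h1 : v z₀ ≤ w z₀ := (hb τ' z₀).trans (hw z₀)
  have h2 : w z₀ = 0 := if_pos rfl
  rw [h2] at h1
  have h3 : (v z₀ : ℝ) ≤ 0 := h1
  have h4 : (0 : ℝ) ≤ u z₀ := (u z₀).2.1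
  linarith

/-- Comparison of a strategy with switch set `{x}` with any strategy agreeing with it at `x`. -/
theorem value_le_of_agree (G : SSG V) (σ σ' : G.MaxStrategy) (τ τ' : G.MinStrategy) {x : V}
    (hx : x ∈ G.VMax) (hs : G.switchSet σ τ = {x}) (hb' : G.IsBestResponse σ' τ')
    (he : σ'.toFun x = σ.toFun x) : G.value σ' τ' ≤ G.value σ τ := by
  refine (hb' τ).trans (G.value_le_value _ _ _ _ ?_ ?_)
  · intro z hz
    by_cases h : z = x
    · subst h; rw [he, ← value_max _ _ _ hz]
    · by_contra! hlt
      have : z ∈ G.switchSet σ τ := ⟨hz, _, σ'.mem_succ z hz, hlt⟩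
      rw [hs] at this
      exact h this
  · intro z hz; exact (G.value_min σ τ hz).ge

end SSG

/-- in an SSG possessing an optimal MAX strategy, if `x ∈ V_MAX` has exactly
`d` out-neighbours, then any family of MAX strategies whose switch sets all equal `{x}` and
whose value vectors are pairwise distinct has cardinality at most `d - 1`. -/
theorem card_singleton_switchSet_le {V : Type*} [Fintype V] [DecidableEq V] (G : SSG V)
    (hopt : ∃ σs : G.MaxStrategy, G.IsOptimal σs)
    (x : V) (hx : x ∈ G.VMax) (d : ℕ) (hd : (G.succ x).card = d)
    (S : Set G.MaxStrategy) (br : G.MaxStrategy → G.MinStrategy)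
    (hbr : ∀ σ ∈ S, G.IsBestResponse σ (br σ))
    (hswitch : ∀ σ ∈ S, G.switchSet σ (br σ) = {x})
    (hdist : ∀ σ₁ ∈ S, ∀ σ₂ ∈ S, σ₁ ≠ σ₂ → G.value σ₁ (br σ₁) ≠ G.value σ₂ (br σ₂)) :
    S.ncard ≤ d - 1 := by

  obtain ⟨σs, hσs⟩ := hopt
  obtain ⟨τs, hτs⟩ := G.exists_br σs
  have hcard : (((G.succ x).erase (σs.toFun x) : Finset V) : Set V).ncard = d - 1 := by
    rw [Set.ncard_coe_finset, Finset.card_erase_of_mem (σs.mem_succ x hx), hd]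
  rw [← hcard]
  refine Set.ncard_le_ncard_of_injOn (fun σ => σ.toFun x) ?_ ?_ (Finset.finite_toSet _)
  · intro σ hσ
    rw [Finset.mem_coe, Finset.mem_erase]
    refine ⟨fun he => ?_, σ.mem_succ x hx⟩
    have h1 := G.value_le_of_agree σ σs (br σ) τs hx (hswitch σ hσ) hτs he.symm
    have h2 : x ∈ G.switchSet σ (br σ) := by rw [hswitch σ hσ]; rfl
    obtain ⟨_, y, hy, hlt⟩ := h2
    obtain ⟨τ', hτ'⟩ := G.exists_br (G.updMax σ x y hx hy)
    have h3 := G.switch_improves σ (br σ) (hbr σ hσ) hx hy hlt τ'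
    have h4 := (hσs τs hτs _ τ' hτ').trans h1
    have h5 := h4 x
    rw [G.value_max (G.updMax σ x y hx hy) τ' hx] at h5
    have h6 := h3 y
    simp only [SSG.updMax, Function.update_self] at h5 h6
    exact absurd (h6.trans h5) (not_le.2 hlt)
  · intro σ₁ h₁ σ₂ h₂ he
    by_contra hne
    refine hdist σ₁ h₁ σ₂ h₂ hne (le_antisymm ?_ ?_)
    · exact G.value_le_of_agree σ₂ σ₁ _ _ hx (hswitch _ h₂) (hbr _ h₁) he
    · exact G.value_le_of_agree σ₁ σ₂ _ _ hx (hswitch _ h₁) (hbr _ h₂) he.symm
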